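/- Let L1, L2 : ℝ^d × ℝ^p → ℝ, α > 0, ℓ10 ≥ 0, ℓ21 ≥ 0, μ2 > 0. Assume: (a) L1 is ℓ10-Lipschitz jointly: |L1(ω, λ) − L1(ω′, λ′)| ≤ ℓ10(‖ω − ω′‖ + ‖λ − λ′‖); (b) for each λ, u ↦ L2(u, λ) is differentiable, μ2-strongly convex, has ℓ21-Lipschitz gradient, and is minimized at u*(λ); (c) for each λ, ω*_α(λ) minimizes ω ↦ L1(ω, λ) + αL2(ω, λ), satisfies the stationarity condition ∇_ω L1(ω*_α(λ), λ) + α∇_ω L2(ω*_α(λ), λ) = 0, and the map λ ↦ ω*_α(λ) is (3ℓ21/μ2)-Lipschitz. Define Γ^α(λ) = L1(ω*_α(λ), λ) + α(L2(ω*_α(λ), λ) − L2(u*(λ), λ)). Then for all λ0, λ′ ∈ ℝ^p: Γ^α(λ0) − Γ^α(λ′) ≤ ℓ10(1 + 3ℓ21/μ2)‖λ0 − λ′‖ + ℓ21ℓ10²/(μ2²·α). -/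

import Mathlib

noncomputable section

open scoped RealInnerProductSpace

/-- near-Lipschitz bound for the penalized value function
Γ^α(λ) = L1(ω*_α(λ), λ) + α(L2(ω*_α(λ), λ) − L2(u*(λ), λ)). -/
theorem penalized_value_function_near_lipschitz
    (d p : ℕ) (hd : 0 < d) (hp : 0 < p)
    (L1 L2 : EuclideanSpace ℝ (Fin d) → EuclideanSpace ℝ (Fin p) → ℝ)
    (α ℓ10 ℓ21 μ2 : ℝ)
    (hα : 0 < α) (hℓ10 : 0 ≤ ℓ10) (hℓ21 : 0 ≤ ℓ21) (hμ2 : 0 < μ2)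
    (hL1lip : ∀ ω ω' lam lam',
      |L1 ω lam - L1 ω' lam'| ≤ ℓ10 * (‖ω - ω'‖ + ‖lam - lam'‖))
    (hL2diff : ∀ lam, Differentiable ℝ fun u => L2 u lam)
    (hL2sc : ∀ lam x y, L2 x lam ≥ L2 y lam +
      ⟪gradient (fun u => L2 u lam) y, x - y⟫ + μ2 / 2 * ‖x - y‖ ^ 2)
    (hL2grad : ∀ lam x y,
      ‖gradient (fun u => L2 u lam) x - gradient (fun u => L2 u lam) y‖
        ≤ ℓ21 * ‖x - y‖)
    (uStar ωα : EuclideanSpace ℝ (Fin p) → EuclideanSpace ℝ (Fin d))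
    (huStar : ∀ lam u, L2 (uStar lam) lam ≤ L2 u lam)
    (hωαMin : ∀ lam ω,
      L1 (ωα lam) lam + α * L2 (ωα lam) lam ≤ L1 ω lam + α * L2 ω lam)
    (hωαStat : ∀ lam, gradient (fun ω => L1 ω lam + α * L2 ω lam) (ωα lam) = 0)
    (hωαLip : ∀ lam lam', ‖ωα lam - ωα lam'‖ ≤ 3 * ℓ21 / μ2 * ‖lam - lam'‖) :
    ∀ lam0 lam' : EuclideanSpace ℝ (Fin p),
      (L1 (ωα lam0) lam0 + α * (L2 (ωα lam0) lam0 - L2 (uStar lam0) lam0)) -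
          (L1 (ωα lam') lam' + α * (L2 (ωα lam') lam' - L2 (uStar lam') lam'))
        ≤ ℓ10 * (1 + 3 * ℓ21 / μ2) * ‖lam0 - lam'‖ + ℓ21 * ℓ10 ^ 2 / (μ2 ^ 2 * α) := by
  intro lam0 lam'
  have hμℓ : μ2 ≤ ℓ21 := by
    obtain ⟨x, hx⟩ : ∃ x : EuclideanSpace ℝ (Fin d), ‖x‖ = 1 :=
      ⟨EuclideanSpace.single ⟨0, hd⟩ 1, by simp⟩
    have h1 := hL2sc lam0 x 0
    have h2 := hL2sc lam0 0 x
    have h3 := hL2grad lam0 x 0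
    have h4 := real_inner_le_norm
      (gradient (fun u => L2 u lam0) x - gradient (fun u => L2 u lam0) 0) x
    rw [inner_sub_left] at h4
    simp only [sub_zero, zero_sub, inner_neg_right, norm_neg, hx] at h1 h2 h3 h4
    linarith
  have hgap : α * (L2 (ωα lam0) lam0 - L2 (uStar lam0) lam0) ≤ ℓ10 ^ 2 / (μ2 * α) := by
    obtain ⟨v, hv⟩ : ∃ v, ωα lam0 = uStar lam0 + (v + v) :=
      ⟨(1 / 2 : ℝ) • (ωα lam0 - uStar lam0), by rw [← add_smul]; norm_num⟩
    have h1 := hL2sc lam0 (ωα lam0) (uStar lam0 + v)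
    have h2 := hL2sc lam0 (uStar lam0) (uStar lam0 + v)
    have h3 := hωαMin lam0 (uStar lam0 + v)
    have h4 := (abs_le.1 (hL1lip (uStar lam0 + v) (ωα lam0) lam0 lam0)).2
    have e1 : ωα lam0 - (uStar lam0 + v) = v := by rw [hv]; abel
    have e2 : uStar lam0 - (uStar lam0 + v) = -v := by abel
    rw [norm_sub_rev, e1, sub_self, norm_zero, add_zero] at h4
    rw [e1] at h1
    rw [e2, inner_neg_right, norm_neg] at h2
    rw [le_div_iff₀ (by positivity)]
    set D := L2 (ωα lam0) lam0 - L2 (uStar lam0) lam0 with hD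
    have h5 : α * D ≤ 2 * ℓ10 * ‖v‖ - α * μ2 * ‖v‖ ^ 2 := by
      have : D ≤ 2 * (L2 (ωα lam0) lam0 - L2 (uStar lam0 + v) lam0) - μ2 * ‖v‖ ^ 2 := by
        linarith
      have := mul_le_mul_of_nonneg_left this hα.le
      linarith
    have h6 := mul_le_mul_of_nonneg_right h5 (mul_pos hμ2 hα).le
    nlinarith [sq_nonneg (ℓ10 - α * μ2 * ‖v‖)]
  have hle : ℓ10 ^ 2 / (μ2 * α) ≤ ℓ21 * ℓ10 ^ 2 / (μ2 ^ 2 * α) := by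
    rw [div_le_div_iff₀ (by positivity) (by positivity)]
    have : 0 ≤ ℓ10 ^ 2 * μ2 * α := by positivity
    nlinarith [mul_le_mul_of_nonneg_left hμℓ this]
  have hpos : 0 ≤ α * (L2 (ωα lam') lam' - L2 (uStar lam') lam') :=
    mul_nonneg hα.le (sub_nonneg.2 (huStar _ _))
  have hL := (abs_le.1 (hL1lip (ωα lam0) (ωα lam') lam0 lam')).2
  have hW := mul_le_mul_of_nonneg_left (hωαLip lam0 lam') hℓ10
  linarith

end
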